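/- Fix n ≥ 1. Let ξ ∈ L¹(Ω, F_{n-1}, P) be a random variable such that ξ∘τ = ξ P-almost surely for every measurable bijection τ : Ω → Ω whose image law P∘τ^{-1} is equivalent to P, for which τ'(ω) := (τ(ω)_1, …, τ(ω)_{n-1}) is F_{n-1}-measurable, and which satisfies τ(ω)_k = ω_k for all k ≥ n and ω ∈ Ω. Then ξ is almost surely constant: ξ = E[ξ] P-almost surely. -/

import Mathlib

open MeasureTheory Set Filter Topology
open scoped unitInterval RealInnerProductSpace ENNReal NNReal

noncomputable section

namespace DGameFormal

/-! ### The canonical sample space `Ω = ([0,1]²)^ℕ` -/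

/-- The sample space `Ω = ([0,1]²)^ℕ`.  The `j`-th coordinate mapping `ζ_{j+1}` of the paper is
`ω ↦ ω j` (we use `0`-based indexing, so the paper's `ζ_j`, `j ≥ 1`, is `ω ↦ ω (j-1)`). -/
abbrev Omega : Type := ℕ → (I × I)

/-- `𝓕_j`: the σ-field generated by the first `j` coordinate mappings `ζ_1, …, ζ_j`. -/
def Fsig (j : ℕ) : MeasurableSpace Omega :=
  MeasurableSpace.comap (fun ω (i : Fin j) => ω (i : ℕ)) inferInstance

/-- `𝓖_{j+1}`: the σ-field generated by the first component of the coordinate `ζ_{j+1}`. -/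
def Gsig (j : ℕ) : MeasurableSpace Omega :=
  MeasurableSpace.comap (fun ω => (ω j).1) inferInstance

/-- `𝓗_{j+1}`: the σ-field generated by the second component of the coordinate `ζ_{j+1}`. -/
def Hsig (j : ℕ) : MeasurableSpace Omega :=
  MeasurableSpace.comap (fun ω => (ω j).2) inferInstance

/-- `P` is the countable product `λ₂^{⊗ℕ}` of the two-dimensional Lebesgue (Borel) measure on the
unit square: it has the prescribed finite-dimensional distributions. -/
def IsProductMeasure (P : Measure Omega) : Prop :=
  ∀ m : ℕ, P.map (fun ω (i : Fin m) => ω (i : ℕ))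
      = Measure.pi (fun _ : Fin m => (volume : Measure (I × I)))

/-! ### Partitions of `[0,T]` -/

/-- A partition `0 = t_0 < t_1 < ⋯ < t_n = T` of the interval `[0,T]`. -/
structure Partition (T : ℝ) where
  n : ℕ
  npos : 0 < n
  t : ℕ → ℝ
  map_zero : t 0 = 0
  map_last : t n = T
  mono : ∀ i < n, t i < t (i + 1)

/-- The mesh `|Π|`: the maximal distance between two neighbouring points of the partition. -/
def Partition.mesh {T : ℝ} (π : Partition T) : ℝ :=
  (Finset.range π.n).sup' (Finset.nonempty_range_iff.2 π.npos.ne') fun i => π.t (i + 1) - π.t i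

open scoped Classical in
/-- For `t ∈ [t_i, t_{i+1})` the index `i` (and `n - 1` for `t ≥ t_{n-1}`). -/
def Partition.idx {T : ℝ} (π : Partition T) (s : ℝ) : ℕ :=
  Nat.findGreatest (fun i => π.t i ≤ s) (π.n - 1)

/-! ### Admissible controls along a partition -/

variable (U V : Type) [MeasurableSpace U] [MeasurableSpace V]

/-- Admissible controls for Player 1 along the partition `π`: measurable processes `u` such that on
each interval `[t_{j-1}, t_j)` of the partition, `u` is a countable sum `Σ_k 1_{Γ_{j,k}} u^{j,k}`
where `(Γ_{j,k})_k ⊆ 𝓕_{j-1}` is a partition of `Ω` and each `u^{j,k}` is `𝓖_j`-measurable. -/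
def AdmControl1 {T : ℝ} (π : Partition T) : Set (ℝ → Omega → U) :=
  {u | Measurable (Function.uncurry u) ∧
    ∀ j < π.n, ∃ (Γ : ℕ → Set Omega) (w : ℕ → ℝ → Omega → U),
      (∀ k, MeasurableSet[Fsig j] (Γ k)) ∧
      Pairwise (Function.onFun Disjoint Γ) ∧
      (⋃ k, Γ k) = univ ∧
      (∀ k s, Measurable[Gsig j] (w k s)) ∧
      (∀ k, ∀ ω ∈ Γ k, ∀ s ∈ Ico (π.t j) (π.t (j + 1)), u s ω = w k s ω)}

/-- Admissible controls for Player 2 along the partition `π` (with `𝓗_j` in place of `𝓖_j`). -/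
def AdmControl2 {T : ℝ} (π : Partition T) : Set (ℝ → Omega → V) :=
  {v | Measurable (Function.uncurry v) ∧
    ∀ j < π.n, ∃ (Γ : ℕ → Set Omega) (w : ℕ → ℝ → Omega → V),
      (∀ k, MeasurableSet[Fsig j] (Γ k)) ∧
      Pairwise (Function.onFun Disjoint Γ) ∧
      (⋃ k, Γ k) = univ ∧
      (∀ k s, Measurable[Hsig j] (w k s)) ∧
      (∀ k, ∀ ω ∈ Γ k, ∀ s ∈ Ico (π.t j) (π.t (j + 1)), v s ω = w k s ω)}

/-! ### Nonanticipative strategies with delay (NAD strategies) -/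

/-- A stopping time `τ : Ω → {0, 1, …, n-1}` of the discrete filtration `(𝓕_j)_j`. -/
def IsStoppingIdx {T : ℝ} (π : Partition T) (τ : Omega → ℕ) : Prop :=
  (∀ ω, τ ω < π.n) ∧ ∀ j, MeasurableSet[Fsig j] {ω | τ ω = j}

variable {U V}

/-- `u = u'`, `ds⊗dP`-a.e. on the stochastic interval `[[t, b]] = {(s,ω) | t ≤ s ≤ b ω}`. -/
def aeStEq {α : Type*} (P : Measure Omega) (t : ℝ) (b : Omega → ℝ)
    (u u' : ℝ → Omega → α) : Prop :=
  ∀ᵐ p ∂((volume : Measure ℝ).prod P), t ≤ p.1 → p.1 ≤ b p.2 → u p.1 p.2 = u' p.1 p.2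

/-- `u = u'`, `ds⊗dP`-a.e. on `[a,b] × Ω`. -/
def aeEqIcc {α : Type*} (P : Measure Omega) (a b : ℝ) (u u' : ℝ → Omega → α) : Prop :=
  ∀ᵐ p ∂((volume : Measure ℝ).prod P), p.1 ∈ Icc a b → u p.1 p.2 = u' p.1 p.2

variable (U V)

/-- NAD strategies for Player 1 on `[t,T]` along `π`: maps from admissible controls of Player 2 to
admissible controls of Player 1 such that controls agreeing `ds⊗dP`-a.e. on `[[t, t_τ]]`, for a
stopping time `τ`, are mapped to controls agreeing `ds⊗dP`-a.e. on `[[t, t_{τ+1}]]`. -/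
def IsNAD1 {T : ℝ} (P : Measure Omega) (π : Partition T) (t : ℝ)
    (α : (ℝ → Omega → V) → (ℝ → Omega → U)) : Prop :=
  (∀ v ∈ AdmControl2 V π, α v ∈ AdmControl1 U π) ∧
  ∀ τ : Omega → ℕ, IsStoppingIdx π τ →
    ∀ v v', v ∈ AdmControl2 V π → v' ∈ AdmControl2 V π →
      aeStEq P t (fun ω => π.t (τ ω)) v v' →
      aeStEq P t (fun ω => π.t (τ ω + 1)) (α v) (α v')

/-- NAD strategies for Player 2 on `[t,T]` along `π`. -/
def IsNAD2 {T : ℝ} (P : Measure Omega) (π : Partition T) (t : ℝ)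
    (β : (ℝ → Omega → U) → (ℝ → Omega → V)) : Prop :=
  (∀ u ∈ AdmControl1 U π, β u ∈ AdmControl2 V π) ∧
  ∀ τ : Omega → ℕ, IsStoppingIdx π τ →
    ∀ u u', u ∈ AdmControl1 U π → u' ∈ AdmControl1 U π →
      aeStEq P t (fun ω => π.t (τ ω)) u u' →
      aeStEq P t (fun ω => π.t (τ ω + 1)) (β u) (β u')

/-! ### The controlled dynamics -/

variable {U V}
variable {d : ℕ}

/-- `X` is the (continuous) solution on `[t,T]` of `X_s = x + ∫_t^s f(r, X_r, u_r, v_r) dr`. -/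
def IsSol (f : ℝ → EuclideanSpace ℝ (Fin d) → U → V → EuclideanSpace ℝ (Fin d)) (T t : ℝ)
    (x : EuclideanSpace ℝ (Fin d)) (u : ℝ → U) (v : ℝ → V)
    (X : ℝ → EuclideanSpace ℝ (Fin d)) : Prop :=
  ContinuousOn X (Icc t T) ∧ ∀ s ∈ Icc t T, X s = x + ∫ r in t..s, f r (X r) (u r) (v r)

/-- The solution `X^{t,x,u,v}` (chosen via the axiom of choice; under the standing assumptions it
is the unique continuous solution). -/
def sol (f : ℝ → EuclideanSpace ℝ (Fin d) → U → V → EuclideanSpace ℝ (Fin d)) (T t : ℝ)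
    (x : EuclideanSpace ℝ (Fin d)) (u : ℝ → U) (v : ℝ → V) : ℝ → EuclideanSpace ℝ (Fin d) :=
  Classical.epsilon (IsSol f T t x u v)

/-- `(u,v)` is the couple of admissible controls associated with the couple of NAD strategies
`(α,β)` on `[t, tl]`:  `α(v) = u` and `β(u) = v`, `ds⊗dP`-a.e. on `[t,tl] × Ω`. -/
def IsFixPair {T : ℝ} (P : Measure Omega) (π : Partition T) (t tl : ℝ)
    (α : (ℝ → Omega → V) → (ℝ → Omega → U)) (β : (ℝ → Omega → U) → (ℝ → Omega → V))
    (u : ℝ → Omega → U) (v : ℝ → Omega → V) : Prop :=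
  u ∈ AdmControl1 U π ∧ v ∈ AdmControl2 V π ∧ aeEqIcc P t tl (α v) u ∧ aeEqIcc P t tl (β u) v

variable [Nonempty U] [Nonempty V]

/-- The couple of admissible controls associated with a couple of NAD strategies on `[t,tl]`
(chosen via the axiom of choice; by Lemma 2.1 it exists and is `ds⊗dP`-a.e. unique). -/
def fixPair {T : ℝ} (P : Measure Omega) (π : Partition T) (t tl : ℝ)
    (α : (ℝ → Omega → V) → (ℝ → Omega → U)) (β : (ℝ → Omega → U) → (ℝ → Omega → V)) :
    (ℝ → Omega → U) × (ℝ → Omega → V) :=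
  Classical.epsilon fun p => IsFixPair P π t tl α β p.1 p.2

/-- The state process `X^{t,x,α,β}` associated with a couple of NAD strategies on `[t,tl]`. -/
def solStrat (f : ℝ → EuclideanSpace ℝ (Fin d) → U → V → EuclideanSpace ℝ (Fin d)) {T : ℝ}
    (P : Measure Omega) (π : Partition T) (t tl : ℝ) (x : EuclideanSpace ℝ (Fin d))
    (α : (ℝ → Omega → V) → (ℝ → Omega → U)) (β : (ℝ → Omega → U) → (ℝ → Omega → V))
    (s : ℝ) (ω : Omega) : EuclideanSpace ℝ (Fin d) :=
  sol f T t x (fun r => (fixPair P π t tl α β).1 r ω) (fun r => (fixPair P π t tl α β).2 r ω) s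

/-- The terminal pay-off `g(X_T^{t,x,α,β})`. -/
def payoff (f : ℝ → EuclideanSpace ℝ (Fin d) → U → V → EuclideanSpace ℝ (Fin d))
    (g : EuclideanSpace ℝ (Fin d) → ℝ) {T : ℝ} (P : Measure Omega) (π : Partition T)
    (t : ℝ) (x : EuclideanSpace ℝ (Fin d))
    (α : (ℝ → Omega → V) → (ℝ → Omega → U)) (β : (ℝ → Omega → U) → (ℝ → Omega → V)) :
    Omega → ℝ :=
  fun ω => g (solStrat f P π t T x α β T ω)

/-! ### Essential suprema/infima of families of random variables -/

/-- `S` is the `P`-a.s. least upper bound of the family `(ξ_i)_{i}` of random variables. -/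
def IsEssSupFam {ι : Sort*} (P : Measure Omega) (ξ : ι → Omega → ℝ) (S : Omega → ℝ) : Prop :=
  (∀ i, ξ i ≤ᵐ[P] S) ∧ ∀ W : Omega → ℝ, (∀ i, ξ i ≤ᵐ[P] W) → S ≤ᵐ[P] W

/-- `S` is the `P`-a.s. greatest lower bound of the family `(ξ_i)_{i}` of random variables. -/
def IsEssInfFam {ι : Sort*} (P : Measure Omega) (ξ : ι → Omega → ℝ) (S : Omega → ℝ) : Prop :=
  (∀ i, S ≤ᵐ[P] ξ i) ∧ ∀ W : Omega → ℝ, (∀ i, W ≤ᵐ[P] ξ i) → W ≤ᵐ[P] S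

/-! ### Value functions along a partition -/

variable (U V)

/-- The defining property of the lower value function along `π`:
`S = esssup_{α} essinf_{β} E[g(X_T^{t,x,α,β}) | 𝓕_i]` for `t_i ≤ t < t_{i+1}`. -/
def IsLowerVal (f : ℝ → EuclideanSpace ℝ (Fin d) → U → V → EuclideanSpace ℝ (Fin d))
    (g : EuclideanSpace ℝ (Fin d) → ℝ) {T : ℝ} (P : Measure Omega) (π : Partition T)
    (t : ℝ) (x : EuclideanSpace ℝ (Fin d)) (S : Omega → ℝ) : Prop :=
  ∃ J : {α // IsNAD1 U V P π t α} → Omega → ℝ,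
    (∀ α, IsEssInfFam P
      (fun β : {β // IsNAD2 U V P π t β} => P[payoff f g P π t x α.1 β.1 | Fsig (π.idx t)])
      (J α)) ∧
    IsEssSupFam P J S

/-- The defining property of the upper value function along `π`. -/
def IsUpperVal (f : ℝ → EuclideanSpace ℝ (Fin d) → U → V → EuclideanSpace ℝ (Fin d))
    (g : EuclideanSpace ℝ (Fin d) → ℝ) {T : ℝ} (P : Measure Omega) (π : Partition T)
    (t : ℝ) (x : EuclideanSpace ℝ (Fin d)) (S : Omega → ℝ) : Prop :=
  ∃ J : {β // IsNAD2 U V P π t β} → Omega → ℝ,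
    (∀ β, IsEssSupFam P
      (fun α : {α // IsNAD1 U V P π t α} => P[payoff f g P π t x α.1 β.1 | Fsig (π.idx t)])
      (J β)) ∧
    IsEssInfFam P J S

/-- The lower value function along `π` seen as a random variable. -/
def lowerVal (f : ℝ → EuclideanSpace ℝ (Fin d) → U → V → EuclideanSpace ℝ (Fin d))
    (g : EuclideanSpace ℝ (Fin d) → ℝ) {T : ℝ} (P : Measure Omega) (π : Partition T)
    (t : ℝ) (x : EuclideanSpace ℝ (Fin d)) : Omega → ℝ :=
  Classical.epsilon (IsLowerVal U V f g P π t x)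

/-- The upper value function along `π` seen as a random variable. -/
def upperVal (f : ℝ → EuclideanSpace ℝ (Fin d) → U → V → EuclideanSpace ℝ (Fin d))
    (g : EuclideanSpace ℝ (Fin d) → ℝ) {T : ℝ} (P : Measure Omega) (π : Partition T)
    (t : ℝ) (x : EuclideanSpace ℝ (Fin d)) : Omega → ℝ :=
  Classical.epsilon (IsUpperVal U V f g P π t x)

/-- The (deterministic) lower value function along `π`: the expectation of `lowerVal`. -/
def lowerValD (f : ℝ → EuclideanSpace ℝ (Fin d) → U → V → EuclideanSpace ℝ (Fin d))
    (g : EuclideanSpace ℝ (Fin d) → ℝ) {T : ℝ} (P : Measure Omega) (π : Partition T)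
    (t : ℝ) (x : EuclideanSpace ℝ (Fin d)) : ℝ :=
  ∫ ω, lowerVal U V f g P π t x ω ∂P

/-- The (deterministic) upper value function along `π`: the expectation of `upperVal`. -/
def upperValD (f : ℝ → EuclideanSpace ℝ (Fin d) → U → V → EuclideanSpace ℝ (Fin d))
    (g : EuclideanSpace ℝ (Fin d) → ℝ) {T : ℝ} (P : Measure Omega) (π : Partition T)
    (t : ℝ) (x : EuclideanSpace ℝ (Fin d)) : ℝ :=
  ∫ ω, upperVal U V f g P π t x ω ∂P

/-! ### The Hamiltonian and viscosity solutions -/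

section Hamiltonian

variable (U V : Type) [MetricSpace U] [MetricSpace V] [MeasurableSpace U] [MeasurableSpace V]

/-- `f̃(t,x,μ,ν) = ∫_U ∫_V f(t,x,u,v) μ(du) ν(dv)` for mixed actions `μ ∈ Δ(U)`, `ν ∈ Δ(V)`. -/
def ftilde (f : ℝ → EuclideanSpace ℝ (Fin d) → U → V → EuclideanSpace ℝ (Fin d))
    (t : ℝ) (x : EuclideanSpace ℝ (Fin d)) (μ : ProbabilityMeasure U) (ν : ProbabilityMeasure V) :
    EuclideanSpace ℝ (Fin d) :=
  ∫ u, ∫ v, f t x u v ∂(ν : Measure V) ∂(μ : Measure U)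

/-- The Hamiltonian `sup_{μ ∈ ΔU} inf_{ν ∈ ΔV} f̃(t,x,μ,ν)·p`. -/
def ham (f : ℝ → EuclideanSpace ℝ (Fin d) → U → V → EuclideanSpace ℝ (Fin d))
    (t : ℝ) (x p : EuclideanSpace ℝ (Fin d)) : ℝ :=
  ⨆ μ : ProbabilityMeasure U, ⨅ ν : ProbabilityMeasure V, ⟪ftilde U V f t x μ ν, p⟫

/-- Viscosity subsolution of `∂_t W + sup_μ inf_ν f̃(t,x,μ,ν)·∇W = 0`, `W(T,·) = g`, on
`[0,T] × ℝ^d`. -/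
def IsViscSubsol (f : ℝ → EuclideanSpace ℝ (Fin d) → U → V → EuclideanSpace ℝ (Fin d))
    (g : EuclideanSpace ℝ (Fin d) → ℝ) (T : ℝ) (W : ℝ → EuclideanSpace ℝ (Fin d) → ℝ) : Prop :=
  (∀ x, W T x ≤ g x) ∧
  ∀ φ : ℝ → EuclideanSpace ℝ (Fin d) → ℝ,
    ContDiff ℝ 1 (fun q : ℝ × EuclideanSpace ℝ (Fin d) => φ q.1 q.2) →
    ∀ t x, t ∈ Ico (0 : ℝ) T →
      IsLocalMaxOn (fun q : ℝ × EuclideanSpace ℝ (Fin d) => W q.1 q.2 - φ q.1 q.2)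
        (Icc (0 : ℝ) T ×ˢ univ) (t, x) →
      0 ≤ deriv (fun s => φ s x) t + ham U V f t x (gradient (fun y => φ t y) x)

/-- Viscosity supersolution of `∂_t W + sup_μ inf_ν f̃(t,x,μ,ν)·∇W = 0`, `W(T,·) = g`, on
`[0,T] × ℝ^d`. -/
def IsViscSupersol (f : ℝ → EuclideanSpace ℝ (Fin d) → U → V → EuclideanSpace ℝ (Fin d))
    (g : EuclideanSpace ℝ (Fin d) → ℝ) (T : ℝ) (W : ℝ → EuclideanSpace ℝ (Fin d) → ℝ) : Prop :=
  (∀ x, g x ≤ W T x) ∧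
  ∀ φ : ℝ → EuclideanSpace ℝ (Fin d) → ℝ,
    ContDiff ℝ 1 (fun q : ℝ × EuclideanSpace ℝ (Fin d) => φ q.1 q.2) →
    ∀ t x, t ∈ Ico (0 : ℝ) T →
      IsLocalMinOn (fun q : ℝ × EuclideanSpace ℝ (Fin d) => W q.1 q.2 - φ q.1 q.2)
        (Icc (0 : ℝ) T ×ˢ univ) (t, x) →
      deriv (fun s => φ s x) t + ham U V f t x (gradient (fun y => φ t y) x) ≤ 0

end Hamiltonian

/-! ### Families of measure-preserving bijections acting transitively -/

/-- A jointly measurable family `(R y)_y` of measure-preserving bijections of `(X, μ)` such that,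
for almost every starting point `x`, the orbit map `y ↦ R y x` carries `ν` to `μ`. -/
structure IsTransitiveFamily {X Y : Type*} [MeasurableSpace X] [MeasurableSpace Y]
    (μ : Measure X) (ν : Measure Y) (R : Y → X → X) : Prop where
  measurable_uncurry : Measurable (Function.uncurry R)
  bijective : ∀ y, Function.Bijective (R y)
  measurePreserving : ∀ y, MeasurePreserving (R y) μ μ
  orbit : ∀ᵐ x ∂μ, MeasurePreserving (fun y => R y x) ν μ

namespace IsTransitiveFamily

variable {X Y : Type*} [MeasurableSpace X] [MeasurableSpace Y]
  {μ : Measure X} {ν : Measure Y} {R : Y → X → X}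

/-- A measurable function invariant under a transitive family is almost everywhere constant. -/
theorem exists_ae_eq_const [SFinite μ] [NeZero μ] [SFinite ν] (hR : IsTransitiveFamily μ ν R)
    {f : X → ℝ} (hf : Measurable f) (hinv : ∀ y, ∀ᵐ x ∂μ, f (R y x) = f x) :
    ∃ c, f =ᵐ[μ] fun _ => c := by
  have hmeas : MeasurableSet {p : Y × X | f (R p.1 p.2) = f p.2} :=
    measurableSet_eq_fun (hf.comp hR.measurable_uncurry) (hf.comp measurable_snd)
  have h := (Measure.ae_ae_comm (p := fun y x => f (R y x) = f x) hmeas).1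
    (ae_of_all ν hinv)
  obtain ⟨x₀, hx₀, horb⟩ := (h.and hR.orbit).exists
  refine ⟨f x₀, ?_⟩
  rw [← horb.map_eq]
  exact (ae_map_iff horb.measurable.aemeasurable
    (measurableSet_eq_fun hf measurable_const)).2 hx₀

theorem prod {X' Y' : Type*} [MeasurableSpace X'] [MeasurableSpace Y']
    {μ' : Measure X'} {ν' : Measure Y'} {R' : Y' → X' → X'}
    [SFinite μ] [SFinite μ'] [SFinite ν] [SFinite ν']
    (hR : IsTransitiveFamily μ ν R) (hR' : IsTransitiveFamily μ' ν' R') :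
    IsTransitiveFamily (μ.prod μ') (ν.prod ν') (fun y => Prod.map (R y.1) (R' y.2)) where
  measurable_uncurry := by
    refine Measurable.prodMk ?_ ?_
    · exact hR.measurable_uncurry.comp
        ((measurable_fst.comp measurable_fst).prodMk (measurable_fst.comp measurable_snd))
    · exact hR'.measurable_uncurry.comp
        ((measurable_snd.comp measurable_fst).prodMk (measurable_snd.comp measurable_snd))
  bijective y := (hR.bijective y.1).prodMap (hR'.bijective y.2)
  measurePreserving y := (hR.measurePreserving y.1).prod (hR'.measurePreserving y.2)
  orbit := by
    filter_upwards [Measure.quasiMeasurePreserving_fst.ae hR.orbit,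
      Measure.quasiMeasurePreserving_snd.ae hR'.orbit] with x hx hx'
    exact hx.prod hx'

theorem pi {ι : Type*} [Fintype ι] [SigmaFinite μ] [SigmaFinite ν]
    (hR : IsTransitiveFamily μ ν R) :
    IsTransitiveFamily (Measure.pi fun _ : ι => μ) (Measure.pi fun _ : ι => ν)
      (fun y x i => R (y i) (x i)) where
  measurable_uncurry := measurable_pi_iff.2 fun i => by
    have hi : Measurable fun p : (ι → Y) × (ι → X) => (p.1 i, p.2 i) := by fun_prop
    exact hR.measurable_uncurry.comp hi
  bijective y := Function.Bijective.piMap fun i => hR.bijective (y i)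
  measurePreserving y := measurePreserving_pi _ _ fun i => hR.measurePreserving (y i)
  orbit := by
    have h : ∀ i : ι, ∀ᵐ x ∂(Measure.pi fun _ : ι => μ),
        MeasurePreserving (fun y => R y (x i)) ν μ := fun i =>
      (Measure.quasiMeasurePreserving_eval (μ := fun _ : ι => μ) i).ae hR.orbit
    filter_upwards [ae_all_iff.2 h] with x hx
    exact measurePreserving_pi _ _ hx

end IsTransitiveFamily

/-! ### Rotations of the unit interval -/

/-- The covering map from the unit interval to the circle. -/
def toCircle (x : I) : UnitAddCircle := ((x : ℝ) : UnitAddCircle)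

/-- The section of `toCircle` with values in `(0,1]`. -/
def ofCircle (c : UnitAddCircle) : I :=
  ⟨AddCircle.measurableEquivIoc 1 0 c,
    Ioc_subset_Icc_self (by simpa using (AddCircle.measurableEquivIoc 1 0 c).2)⟩

theorem toCircle_ofCircle (c : UnitAddCircle) : toCircle (ofCircle c) = c :=
  (AddCircle.measurableEquivIoc 1 0).symm_apply_apply c

theorem ofCircle_ne_zero (c : UnitAddCircle) : ofCircle c ≠ 0 := by
  intro h
  have h1 : ((AddCircle.measurableEquivIoc 1 0 c : Ioc (0 : ℝ) (0 + 1)) : ℝ) = 0 :=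
    congrArg Subtype.val h
  exact (AddCircle.measurableEquivIoc 1 0 c).2.1.ne' h1

theorem ofCircle_toCircle {x : I} (hx : x ≠ 0) : ofCircle (toCircle x) = x := by
  have hmem : (x : ℝ) ∈ Ioc (0 : ℝ) (0 + 1) :=
    ⟨unitInterval.pos_iff_ne_zero.2 hx, by simpa using x.2.2⟩
  have h := (AddCircle.measurableEquivIoc 1 0).apply_symm_apply ⟨(x : ℝ), hmem⟩
  exact Subtype.ext (congrArg (fun z : Ioc (0 : ℝ) (0 + 1) => (z : ℝ)) h)

theorem measurable_ofCircle : Measurable ofCircle :=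
  (measurable_subtype_coe.comp (AddCircle.measurableEquivIoc 1 0).measurable).subtype_mk

theorem measurePreserving_toCircle : MeasurePreserving toCircle volume volume := by
  have h1 : MeasurePreserving ((↑) : ℝ → UnitAddCircle) (volume.restrict I) volume := by
    have h := AddCircle.measurePreserving_mk 1 0
    rw [zero_add, restrict_Ioc_eq_restrict_Icc] at h
    exact h
  exact h1.comp unitInterval.measurePreserving_coe

theorem ae_ne_zero_unitInterval : ∀ᵐ x : I, x ≠ 0 :=
  Measure.ae_ne volume 0

theorem measurePreserving_ofCircle : MeasurePreserving ofCircle volume volume := by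
  refine ⟨measurable_ofCircle, ?_⟩
  rw [← measurePreserving_toCircle.map_eq,
    Measure.map_map measurable_ofCircle measurePreserving_toCircle.measurable]
  have h : ofCircle ∘ toCircle =ᵐ[volume] id := by
    filter_upwards [ae_ne_zero_unitInterval] with x hx using ofCircle_toCircle hx
  rw [Measure.map_congr h, Measure.map_id]

open scoped Classical in
/-- Rotation of `(0,1]` by the angle `c`, fixing the endpoint `0`. -/
def rotation (c : UnitAddCircle) (x : I) : I :=
  if x = 0 then 0 else ofCircle (toCircle x + c)

theorem rotation_of_ne_zero (c : UnitAddCircle) {x : I} (hx : x ≠ 0) :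
    rotation c x = ofCircle (toCircle x + c) := if_neg hx

theorem rotation_rotation_neg (c : UnitAddCircle) (x : I) : rotation c (rotation (-c) x) = x := by
  by_cases hx : x = 0
  · simp [rotation, hx]
  · rw [rotation_of_ne_zero _ hx, rotation_of_ne_zero _ (ofCircle_ne_zero _), toCircle_ofCircle,
      neg_add_cancel_right, ofCircle_toCircle hx]

theorem isTransitiveFamily_rotation :
    IsTransitiveFamily (volume : Measure I) (volume : Measure UnitAddCircle) rotation where
  measurable_uncurry := by
    refine Measurable.ite (measurable_snd (measurableSet_singleton 0)) measurable_const ?_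
    exact measurable_ofCircle.comp
      ((measurePreserving_toCircle.measurable.comp measurable_snd).add measurable_fst)
  bijective c := by
    refine Function.bijective_iff_has_inverse.2 ⟨rotation (-c), fun x => ?_, fun x => ?_⟩
    · simpa using rotation_rotation_neg (-c) x
    · exact rotation_rotation_neg c x
  measurePreserving c := by
    have h := measurePreserving_ofCircle.comp
      ((measurePreserving_add_right volume c).comp measurePreserving_toCircle)
    have hae : ofCircle ∘ (fun y => y + c) ∘ toCircle =ᵐ[volume] rotation c := by
      filter_upwards [ae_ne_zero_unitInterval] with x hx using (rotation_of_ne_zero c hx).symm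
    refine ⟨?_, ?_⟩
    · exact Measurable.ite (measurableSet_singleton 0) measurable_const h.measurable
    · rw [← Measure.map_congr hae, h.map_eq]
  orbit := by
    filter_upwards [ae_ne_zero_unitInterval] with x hx
    have h := measurePreserving_ofCircle.comp (measurePreserving_add_left volume (toCircle x))
    have heq : (fun c => rotation c x) = ofCircle ∘ fun c => toCircle x + c :=
      funext fun c => rotation_of_ne_zero c hx
    rwa [heq]

/-! ### The product measure on the sample space -/

theorem IsProductMeasure.eq_infinitePi {P : Measure Omega} (hP : IsProductMeasure P) :
    P = Measure.infinitePi fun _ : ℕ => (volume : Measure (I × I)) := by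
  classical
  refine Measure.eq_infinitePi _ fun s t ht => ?_
  obtain ⟨m, hm⟩ : ∃ m, s ⊆ Finset.range m :=
    ⟨s.sup id + 1, s.subset_range_sup_succ⟩
  let u : ℕ → Set (I × I) := fun i => if i ∈ s then t i else univ
  have hu : ∀ i, MeasurableSet (u i) := fun i => by
    by_cases hi : i ∈ s <;> simp [u, hi, ht i]
  have hpre : Set.pi s t
      = (fun (ω : Omega) (i : Fin m) => ω (i : ℕ)) ⁻¹' Set.univ.pi fun i : Fin m => u i := by
    ext ω
    simp only [Set.mem_pi, Finset.mem_coe, mem_preimage, mem_univ, forall_const]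
    constructor
    · intro h i
      by_cases hi : (i : ℕ) ∈ s
      · simpa [u, hi] using h i hi
      · simp [u, hi]
    · intro h i hi
      simpa [u, hi] using h ⟨i, Finset.mem_range.1 (hm hi)⟩
  rw [hpre, ← Measure.map_apply (by fun_prop) (MeasurableSet.univ_pi fun i : Fin m => hu i), hP m,
    Measure.pi_pi, Fin.prod_univ_eq_prod_range (fun i => volume (u i)) m,
    ← Finset.prod_subset hm fun i _ hi => by simp [u, hi]]
  exact Finset.prod_congr rfl fun i hi => by simp [u, hi]

/-- **Lemma 3.4.** Fix `n ≥ 1`. Let `ξ ∈ L¹(Ω, 𝓕_{n-1}, P)` be invariant under every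
measurable bijection `τ : Ω → Ω` whose image law `P∘τ⁻¹` is equivalent to `P`, for which
`τ' = (τ(ω)_1, …, τ(ω)_{n-1})` is `𝓕_{n-1}`-measurable, and which satisfies `τ(ω)_k = ω_k` for all
`k ≥ n`.  Then `ξ = E[ξ]`, `P`-a.s.  (Coordinates are `0`-based here: the paper's `ω_k`, `k ≥ 1`,
is `ω (k-1)`, so "`k ≥ n`" becomes "indices `≥ n - 1`".) -/
theorem statement_8
    (P : Measure Omega) [IsProbabilityMeasure P] (hP : IsProductMeasure P)
    (n : ℕ) (hn : 1 ≤ n) (ξ : Omega → ℝ)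
    (hξmeas : Measurable[Fsig (n - 1)] ξ) (hξint : Integrable ξ P)
    (hinv : ∀ τ : Omega → Omega, Measurable τ → Function.Bijective τ →
      P.map τ ≪ P → P ≪ P.map τ →
      Measurable[Fsig (n - 1)] (fun ω (i : Fin (n - 1)) => τ ω (i : ℕ)) →
      (∀ (ω : Omega) (k : ℕ), n - 1 ≤ k → τ ω k = ω k) →
      (fun ω => ξ (τ ω)) =ᵐ[P] ξ) :
    ξ =ᵐ[P] fun _ => ∫ ω, ξ ω ∂P := by
  generalize n - 1 = m at hξmeas hinv
  obtain ⟨h, hh, rfl⟩ := Measurable.exists_eq_measurable_comp hξmeas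
  set pr : Omega → Fin m → I × I := fun ω i => ω (i : ℕ)
  have hpr : Measurable pr := by fun_prop
  let S : UnitAddCircle × UnitAddCircle → I × I → I × I :=
    fun y => Prod.map (rotation y.1) (rotation y.2)
  have hS : IsTransitiveFamily (volume : Measure (I × I)) volume S :=
    isTransitiveFamily_rotation.prod isTransitiveFamily_rotation
  have hinvh : ∀ y : Fin m → UnitAddCircle × UnitAddCircle,
      ∀ᵐ x ∂(Measure.pi fun _ : Fin m => (volume : Measure (I × I))),
        h (fun i => S (y i) (x i)) = h x := by
    intro y
    let g : ℕ → I × I → I × I := fun k => if hk : k < m then S (y ⟨k, hk⟩) else id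
    have hg : ∀ k, MeasurePreserving (g k) volume volume := fun k => by
      by_cases hk : k < m
      · simpa only [g, hk, dite_true] using hS.measurePreserving (y ⟨k, hk⟩)
      · simpa only [g, hk, dite_false] using MeasurePreserving.id volume
    have hgb : ∀ k, Function.Bijective (g k) := fun k => by
      by_cases hk : k < m
      · simpa only [g, hk, dite_true] using hS.bijective (y ⟨k, hk⟩)
      · simpa only [g, hk, dite_false] using Function.bijective_id
    have hgpr : ∀ ω : Omega, pr (fun k => g k (ω k)) = fun i => S (y i) (pr ω i) := fun ω => by
      funext i
      simp [pr, g]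
    have hmap : P.map (fun ω k => g k (ω k)) = P := by
      rw [hP.eq_infinitePi, Measure.infinitePi_map_pi _ fun k => (hg k).measurable]
      simp only [(hg _).map_eq]
    have key := hinv (fun ω k => g k (ω k))
      (measurable_pi_iff.2 fun k => (hg k).measurable.comp (measurable_pi_apply k))
      (Function.Bijective.piMap hgb) (by rw [hmap]) (by rw [hmap])
      (by
        have : (fun (ω : Omega) (i : Fin m) => g i (ω i)) = (fun x i => S (y i) (x i)) ∘ pr :=
          funext hgpr
        rw [this]
        exact (hS.pi.measurePreserving y).measurable.comp (comap_measurable pr))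
      (fun ω k hk => by simp [g, not_lt.2 hk])
    rw [← hP m]
    refine (ae_map_iff hpr.aemeasurable (measurableSet_eq_fun
      (hh.comp (hS.pi.measurePreserving y).measurable) hh)).2 ?_
    filter_upwards [key] with ω hω
    exact (congrArg h (hgpr ω)).symm.trans hω
  obtain ⟨c, hc⟩ := hS.pi.exists_ae_eq_const hh hinvh
  have hcP : h ∘ pr =ᵐ[P] fun _ => c := by
    refine ae_of_ae_map hpr.aemeasurable (p := fun x => h x = c) ?_
    rw [hP m]
    exact hc
  have hint : ∫ ω, (h ∘ pr) ω ∂P = c := by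
    rw [integral_congr_ae hcP]
    simp
  rw [hint]
  exact hcP

end DGameFormal
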